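/- For every k ≥ 4 and n > (k² + k - 2)/2, the size-Ramsey number of the k-uniform tight path on n vertices satisfies R^(k)(P^(k)_{n,k-1}) ≥ ⌈log₂(k+1)⌉·n - 2k². -/

import Mathlib

/-- Edge set of the k-uniform tight path on n vertices, with vertex ordering v 0, ..., v (n-1):
the edges are the images of all length-k intervals of consecutive indices. -/
def tightPathEdges {V : Type*} [DecidableEq V] (v : ℕ → V) (n k : ℕ) : Finset (Finset V) :=
  (Finset.range (n - k + 1)).image fun i => (Finset.Ico i (i + k)).image v

/-- E is (the edge set of) a copy of the k-uniform tight path on n vertices inside G. -/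
def IsTightPathCopy (G : Finset (Finset ℕ)) (n k : ℕ) (E : Finset (Finset ℕ)) : Prop :=
  ∃ v : ℕ → ℕ, Function.Injective v ∧ E = tightPathEdges v n k ∧ E ⊆ G

/-- G → P^(k)_{n,k-1}: every red/blue edge coloring of G yields a monochromatic tight path copy. -/
def arrowsTightPath (G : Finset (Finset ℕ)) (n k : ℕ) : Prop :=
  ∀ c : Finset ℕ → Bool,
    ∃ E : Finset (Finset ℕ), IsTightPathCopy G n k E ∧ ∃ b : Bool, ∀ e ∈ E, c e = b

/-- The size-Ramsey number of the k-uniform tight path on n vertices. -/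
noncomputable def sizeRamseyTightPath (n k : ℕ) : ℕ :=
  sInf {m : ℕ | ∃ G : Finset (Finset ℕ),
    (∀ e ∈ G, e.card = k) ∧ arrowsTightPath G n k ∧ G.card = m}

open Finset

/-- Ramsey's theorem for two-colourings of the `k`-subsets of a finite set of naturals. -/
theorem exists_homogeneous_of_card_le (k n : ℕ) :
    ∃ N : ℕ, ∀ S : Finset ℕ, N ≤ S.card → ∀ c : Finset ℕ → Bool,
      ∃ T ⊆ S, T.card = n ∧ ∃ b : Bool, ∀ e ⊆ T, e.card = k → c e = b := by
  induction k generalizing n with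
  | zero =>
    refine ⟨n, fun S hS c => ?_⟩
    obtain ⟨T, hT, hTn⟩ := exists_subset_card_eq hS
    exact ⟨T, hT, hTn, c ∅, fun e _ he => by rw [card_eq_zero.mp he]⟩
  | succ k ih =>
    have canonical : ∀ s : ℕ, ∃ N : ℕ, ∀ S : Finset ℕ, N ≤ S.card → ∀ c : Finset ℕ → Bool,
        ∃ T ⊆ S, T.card = s ∧ ∃ g : ℕ → Bool, ∀ e ⊆ T, e.card = k + 1 →
          ∀ x ∈ e, (∀ y ∈ e, x ≤ y) → c e = g x := by
      intro s
      induction s with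
      | zero =>
        refine ⟨0, fun S _ c => ⟨∅, empty_subset _, rfl, fun _ => true, fun e he hk => ?_⟩⟩
        rw [subset_empty.mp he] at hk
        simp at hk
      | succ s ihs =>
        obtain ⟨M, hM⟩ := ihs
        obtain ⟨N, hN⟩ := ih M
        refine ⟨N + 1, fun S hS c => ?_⟩
        have hne : S.Nonempty := card_pos.mp (by omega)
        set x := S.min' hne with hx
        have hxS : x ∈ S := min'_mem _ _
        obtain ⟨S', hS', hcard, b, hb⟩ := hN (S.erase x) (by rw [card_erase_of_mem hxS]; omega)
          (fun e => c (insert x e))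
        obtain ⟨T, hT, hTs, g, hg⟩ := hM S' hcard.ge c
        have hTS : T ⊆ S.erase x := hT.trans hS'
        have hxT : x ∉ T := fun h => notMem_erase x S (hTS h)
        have hlt : ∀ y ∈ T, x < y := fun y hy =>
          lt_of_le_of_ne (min'_le _ _ (mem_of_mem_erase (hTS hy))) fun h => hxT (h ▸ hy)
        refine ⟨insert x T, insert_subset hxS (hTS.trans (erase_subset _ _)), ?_,
          Function.update g x b, fun e he hk z hz hmin => ?_⟩
        · rw [card_insert_of_notMem hxT, hTs]
        · by_cases hxe : x ∈ e
          · have hzx : z = x := by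
              rcases mem_insert.mp (he hz) with h | h
              · exact h
              · exact absurd (hmin x hxe) (not_le.mpr (hlt z h))
            have hsub : e.erase x ⊆ T := fun y hy => by
              obtain ⟨h1, h2⟩ := mem_erase.mp hy
              exact (mem_insert.mp (he h2)).resolve_left h1
            have h := hb (e.erase x) (hsub.trans hT) (by rw [card_erase_of_mem hxe, hk]; rfl)
            simp only [insert_erase hxe] at h
            rw [h, hzx, Function.update_self]
          · have hsub : e ⊆ T := fun y hy =>
              (mem_insert.mp (he hy)).resolve_left fun h => hxe (h ▸ hy)
            rw [Function.update_of_ne (show z ≠ x from fun h => hxe (h ▸ hz))]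
            exact hg e hsub hk z hz hmin
    obtain ⟨N, hN⟩ := canonical (2 * n)
    refine ⟨N, fun S hS c => ?_⟩
    obtain ⟨T, hT, hTs, g, hg⟩ := hN S hS c
    have hsplit : ∃ b, n ≤ (T.filter fun x => g x = b).card := by
      by_contra! h
      have h1 := h true
      have h2 := h false
      have h3 := card_filter_add_card_filter_not (s := T) (fun x => g x = true)
      simp only [Bool.not_eq_true] at h3
      omega
    obtain ⟨b, hb⟩ := hsplit
    obtain ⟨T', hT', hcard⟩ := exists_subset_card_eq hb
    refine ⟨T', (hT'.trans (filter_subset _ _)).trans hT, hcard, b, fun e he hk => ?_⟩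
    have hne : e.Nonempty := card_pos.mp (by omega)
    rw [hg e (he.trans (hT'.trans (filter_subset _ _))) hk (e.min' hne) (min'_mem _ _)
      (fun y hy => min'_le _ _ hy)]
    exact (mem_filter.mp (hT' (he (min'_mem _ _)))).2

/-- The `i`-th edge of the tight path with vertex sequence `v`. -/
def pathEdge (v : ℕ → ℕ) (k i : ℕ) : Finset ℕ := (Ico i (i + k)).image v

theorem mem_tightPathEdges {v : ℕ → ℕ} {n k : ℕ} (hkn : k ≤ n) {e : Finset ℕ} :
    e ∈ tightPathEdges v n k ↔ ∃ i, i + k ≤ n ∧ pathEdge v k i = e := by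
  simp only [tightPathEdges, pathEdge, mem_image, mem_range]
  exact exists_congr fun i => and_congr_left fun _ => by omega

theorem card_pathEdge {v : ℕ → ℕ} (hv : Function.Injective v) (k i : ℕ) :
    (pathEdge v k i).card = k := by
  rw [pathEdge, card_image_of_injective _ hv, Nat.card_Ico]
  omega

theorem pathEdge_injective {v : ℕ → ℕ} (hv : Function.Injective v) {k : ℕ} (hk : 0 < k) :
    Function.Injective (pathEdge v k) := by
  intro i j hij
  have h : Ico i (i + k) = Ico j (j + k) := image_injective hv hij
  have hi : i ∈ Ico j (j + k) := h ▸ mem_Ico.mpr ⟨le_rfl, by omega⟩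
  have hj : j ∈ Ico i (i + k) := h ▸ mem_Ico.mpr ⟨le_rfl, by omega⟩
  rw [mem_Ico] at hi hj
  omega

theorem card_pathEdge_inter_succ {v : ℕ → ℕ} (hv : Function.Injective v) (k i : ℕ) :
    k ≤ (pathEdge v k i ∩ pathEdge v k (i + 1)).card + 1 := by
  have hsub : (Ico (i + 1) (i + k)).image v ⊆ pathEdge v k i ∩ pathEdge v k (i + 1) :=
    subset_inter (image_subset_image (Ico_subset_Ico (by omega) le_rfl))
      (image_subset_image (Ico_subset_Ico le_rfl (by omega)))
  have h := card_le_card hsub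
  rw [card_image_of_injective _ hv, Nat.card_Ico] at h
  omega

theorem disjoint_pathEdge {v : ℕ → ℕ} (hv : Function.Injective v) {k i j : ℕ} (hij : i + k ≤ j) :
    Disjoint (pathEdge v k i) (pathEdge v k j) := by
  rw [pathEdge, pathEdge, disjoint_image hv, Finset.disjoint_left]
  intro x hx hx'
  rw [mem_Ico] at hx hx'
  omega

theorem exists_arrowsTightPath {n k : ℕ} (hkn : k ≤ n) :
    ∃ G : Finset (Finset ℕ), (∀ e ∈ G, e.card = k) ∧ arrowsTightPath G n k := by
  obtain ⟨N, hN⟩ := exists_homogeneous_of_card_le k n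
  refine ⟨powersetCard k (range N), fun e he => (mem_powersetCard.mp he).2, fun c => ?_⟩
  obtain ⟨T, hT, hcard, b, hb⟩ := hN (range N) (card_range N).ge c
  let v : ℕ → ℕ := fun i => if h : i < n then T.orderEmbOfFin hcard ⟨i, h⟩ else N + i
  have hvT : ∀ i, i < n → v i ∈ T := fun i hi => by
    simp only [v, dif_pos hi]
    exact T.orderEmbOfFin_mem hcard _
  have hvN : ∀ i, i < n → v i < N := fun i hi => mem_range.mp (hT (hvT i hi))
  have hv : Function.Injective v := by
    intro i j hij
    by_cases hi : i < n <;> by_cases hj : j < n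
    · simp only [v, dif_pos hi, dif_pos hj] at hij
      exact congrArg Fin.val ((T.orderEmbOfFin hcard).injective hij)
    · have := hvN i hi
      simp only [hij, v, dif_neg hj] at this
      omega
    · have := hvN j hj
      simp only [← hij, v, dif_neg hi] at this
      omega
    · simp only [v, dif_neg hi, dif_neg hj] at hij
      omega
  have hsub : ∀ i, i + k ≤ n → pathEdge v k i ⊆ T := fun i hi x hx => by
    obtain ⟨j, hj, rfl⟩ := mem_image.mp hx
    exact hvT j (by rw [mem_Ico] at hj; omega)
  refine ⟨tightPathEdges v n k, ⟨v, hv, rfl, fun e he => ?_⟩, b, fun e he => ?_⟩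
  · obtain ⟨i, hi, rfl⟩ := (mem_tightPathEdges hkn).mp he
    exact mem_powersetCard.mpr ⟨(hsub i hi).trans hT, card_pathEdge hv k i⟩
  · obtain ⟨i, hi, rfl⟩ := (mem_tightPathEdges hkn).mp he
    exact hb _ (hsub i hi) (card_pathEdge hv k i)

/-- If three consecutive sets of a chain of `k`-sets overlap a lot, so do its ends. -/
theorem card_inter_chain_le {e f f' e' : Finset ℕ} {k : ℕ} (hf : f.card = k) (hf' : f'.card = k) :
    (f ∩ e).card + (f ∩ f').card + (f' ∩ e').card ≤ (e ∩ e').card + 2 * k := by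
  have h1 : (f ∩ e ∪ f ∩ f').card ≤ k := hf ▸ card_le_card
    (union_subset inter_subset_left inter_subset_left)
  have h2 := card_union_add_card_inter (f ∩ e) (f ∩ f')
  have h3 : (f ∩ e ∩ (f ∩ f') ∪ f' ∩ e').card ≤ k := hf' ▸ card_le_card
    (union_subset (inter_subset_right.trans inter_subset_right) inter_subset_left)
  have h4 := card_union_add_card_inter (f ∩ e ∩ (f ∩ f')) (f' ∩ e')
  have h5 : (f ∩ e ∩ (f ∩ f') ∩ (f' ∩ e')).card ≤ (e ∩ e').card :=
    card_le_card fun x hx => by simp only [mem_inter] at hx ⊢; tauto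
  omega

/-- If every edge of a tight path has at least `m` vertices in `W`, then `W` is large. -/
theorem mul_le_card_of_forall_pathEdge {v : ℕ → ℕ} (hv : Function.Injective v) {n k m : ℕ}
    {W : Finset ℕ} (h : ∀ i, i + k ≤ n → m ≤ (pathEdge v k i ∩ W).card) :
    n / k * m ≤ W.card := by
  have hdisj : ∀ a ∈ range (n / k), ∀ b ∈ range (n / k), a ≠ b →
      Disjoint (pathEdge v k (a * k) ∩ W) (pathEdge v k (b * k) ∩ W) := by
    intro a _ b _ hab
    refine Disjoint.mono inter_subset_left inter_subset_left ?_
    rcases lt_or_gt_of_ne hab with hlt | hlt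
    · exact disjoint_pathEdge hv (by rw [← Nat.succ_mul]; exact Nat.mul_le_mul_right k hlt)
    · exact (disjoint_pathEdge hv
        (by rw [← Nat.succ_mul]; exact Nat.mul_le_mul_right k hlt)).symm
  calc n / k * m = ∑ _a ∈ range (n / k), m := by simp
    _ ≤ ∑ a ∈ range (n / k), (pathEdge v k (a * k) ∩ W).card := by
        refine sum_le_sum fun a ha => h _ ?_
        rw [← Nat.succ_mul]
        exact (Nat.mul_le_mul_right k (mem_range.mp ha)).trans (Nat.div_mul_le_self n k)
    _ = ((range (n / k)).biUnion fun a => pathEdge v k (a * k) ∩ W).card :=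
        (card_biUnion hdisj).symm
    _ ≤ W.card := card_le_card (biUnion_subset.mpr fun _ _ => inter_subset_right)

/-- `E` splits into classes, named by the values of `l`: the edges of a class lie in the set of at
most `n / 2` vertices naming it, and edges of different classes share at most `k - s` vertices. -/
structure IsSeparated (n k s : ℕ) (E : Finset (Finset ℕ)) (l : Finset ℕ → Finset ℕ) : Prop where
  subset_label : ∀ e ∈ E, e ⊆ l e
  card_label : ∀ e ∈ E, 2 * (l e).card ≤ n
  card_inter : ∀ e ∈ E, ∀ e' ∈ E, l e ≠ l e' → (e ∩ e').card + s ≤ k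

/-- No tight path on `n` vertices has all its edges close to a separated family. -/
theorem IsSeparated.exists_far_pathEdge {n k r : ℕ} {E : Finset (Finset ℕ)}
    {l : Finset ℕ → Finset ℕ} (hE : IsSeparated n k (2 * r) E l) (hk : 0 < k)
    (hn : k ^ 2 + k ≤ 2 * n) (hr : E.Nonempty → 2 * r ≤ k) {v : ℕ → ℕ}
    (hv : Function.Injective v) :
    ∃ i, i + k ≤ n ∧ ∀ e ∈ E, (pathEdge v k i ∩ e).card + r ≤ k := by
  by_contra! h
  have hkn : k ≤ n := by nlinarith
  choose! g hgE hg using h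
  have hrk : 2 * r ≤ k := hr ⟨_, hgE 0 (by omega)⟩
  have hlabel : ∀ i, i + k ≤ n → l (g i) = l (g 0) := by
    intro i
    induction i with
    | zero => intro _; rfl
    | succ i ih =>
      intro hi
      rw [← ih (by omega)]
      by_contra hne
      have h1 := hE.card_inter _ (hgE i (by omega)) _ (hgE (i + 1) hi) (Ne.symm hne)
      have h2 := card_inter_chain_le (e := g i) (e' := g (i + 1))
        (card_pathEdge hv k i) (card_pathEdge hv k (i + 1))
      have h3 := card_pathEdge_inter_succ hv k i
      have h4 := hg i (by omega)
      have h5 := hg (i + 1) hi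
      omega
  have hW := mul_le_card_of_forall_pathEdge hv (n := n) (k := k) (m := k + 1 - r) (W := l (g 0))
    fun i hi => by
      have h1 : (pathEdge v k i ∩ g i).card ≤ (pathEdge v k i ∩ l (g 0)).card :=
        card_le_card (inter_subset_inter_left (hlabel i hi ▸ hE.subset_label _ (hgE i hi)))
      have h2 := hg i hi
      omega
  have hhalf := hE.card_label _ (hgE 0 (by omega))
  have hdiv := Nat.div_add_mod n k
  have hmod := Nat.mod_lt n hk
  set d := n / k
  have hd : k ≤ 2 * d := by
    by_contra! hlt
    nlinarith
  have h2 : k + 2 ≤ 2 * (k + 1 - r) := by omega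
  have h3 : d * (k + 2) ≤ d * (2 * (k + 1 - r)) := Nat.mul_le_mul_left d h2
  nlinarith

/-- The edges of a tight path on `n` vertices inside its first or its last `n / 2` vertices. -/
theorem card_image_pathEdge_halves {v : ℕ → ℕ} (hv : Function.Injective v) {n k : ℕ}
    (hk : 0 < k) (hkn : 2 * k ≤ n) :
    n ≤ (((range (n / 2 + 1 - k)) ∪ Ico (n - n / 2) (n + 1 - k)).image (pathEdge v k)).card
      + 2 * k := by
  rw [card_image_of_injective _ (pathEdge_injective hv hk), card_union_of_disjoint,
    card_range, Nat.card_Ico]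
  · omega
  · rw [Finset.disjoint_left]
    intro x hx hx'
    rw [mem_range] at hx
    rw [mem_Ico] at hx'
    omega

/-- A separated family inside an arrowing hypergraph grows by at least `n - 2 * k` edges when its
separation is halved. -/
theorem IsSeparated.exists_extension {n k r : ℕ} {G E : Finset (Finset ℕ)}
    {l : Finset ℕ → Finset ℕ} (harrow : arrowsTightPath G n k)
    (hEG : E ⊆ G) (hE : IsSeparated n k (2 * r) E l) (hk : 3 ≤ k) (hn : k ^ 2 + k ≤ 2 * n)
    (hr : E.Nonempty → 2 * r ≤ k) (hr0 : 0 < r) (hrk : r ≤ k) :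
    ∃ E' ⊆ G, ∃ l', IsSeparated n k r E' l' ∧ E.card + n ≤ E'.card + 2 * k := by
  classical
  have hkn : 2 * k ≤ n := by nlinarith
  obtain ⟨_, ⟨v, hv, rfl, hvG⟩, b, hb⟩ :=
    harrow fun f => decide (∃ e ∈ E, k < (f ∩ e).card + r)
  have hedge : ∀ i, i + k ≤ n → pathEdge v k i ∈ tightPathEdges v n k := fun i hi =>
    (mem_tightPathEdges (by omega)).mpr ⟨i, hi, rfl⟩
  obtain ⟨i₀, hi₀, hfar₀⟩ := hE.exists_far_pathEdge (by omega) hn hr hv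
  have hbf : b = false := by
    rw [← hb _ (hedge i₀ hi₀), decide_eq_false_iff_not]
    rintro ⟨e, he, hlt⟩
    exact absurd (hfar₀ e he) (not_le.mpr hlt)
  have hfar : ∀ i, i + k ≤ n → ∀ e ∈ E, (pathEdge v k i ∩ e).card + r ≤ k := by
    intro i hi e he
    have h := hb _ (hedge i hi)
    rw [hbf, decide_eq_false_iff_not] at h
    by_contra! hlt
    exact h ⟨e, he, hlt⟩
  set I := range (n / 2 + 1 - k)
  set J := Ico (n - n / 2) (n + 1 - k)
  have hI : ∀ i ∈ I, i + k ≤ n / 2 := fun i hi => by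
    have := mem_range.mp hi
    omega
  have hJ : ∀ i ∈ J, n - n / 2 ≤ i ∧ i + k ≤ n := fun i hi => by
    have := mem_Ico.mp hi
    omega
  have hIJ : ∀ i ∈ I ∪ J, i + k ≤ n := fun i hi => by
    rcases mem_union.mp hi with h | h
    · have := hI i h
      omega
    · exact (hJ i h).2
  have hnotE : ∀ i ∈ I ∪ J, pathEdge v k i ∉ E := fun i hi h => by
    have := hfar i (hIJ i hi) _ h
    rw [inter_self, card_pathEdge hv] at this
    omega
  let l' : Finset ℕ → Finset ℕ := fun f =>
    if f ∈ E then l f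
    else if f ∈ I.image (pathEdge v k) then (range (n / 2)).image v
    else (Ico (n - n / 2) n).image v
  have hl'E : ∀ e ∈ E, l' e = l e := fun e he => if_pos he
  have hl'I : ∀ i ∈ I, l' (pathEdge v k i) = (range (n / 2)).image v := fun i hi => by
    simp only [l', if_neg (hnotE i (mem_union_left _ hi)), if_pos (mem_image_of_mem _ hi)]
  have hl'J : ∀ i ∈ J, l' (pathEdge v k i) = (Ico (n - n / 2) n).image v := fun i hi => by
    have : pathEdge v k i ∉ I.image (pathEdge v k) := fun h => by
      obtain ⟨j, hj, hji⟩ := mem_image.mp h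
      have h1 := pathEdge_injective hv (by omega) hji
      have h2 := hI j hj
      have h3 := hJ i hi
      omega
    simp only [l', if_neg (hnotE i (mem_union_right _ hi)), if_neg this]
  have hIJdisj : ∀ i ∈ I, ∀ j ∈ J, (pathEdge v k i ∩ pathEdge v k j).card = 0 :=
    fun i hi j hj => by
      have h1 := hI i hi
      have h2 := hJ j hj
      rw [card_eq_zero, ← disjoint_iff_inter_eq_empty]
      exact disjoint_pathEdge hv (by omega)
  refine ⟨E ∪ (I ∪ J).image (pathEdge v k), union_subset hEG ?_, l', ⟨?_, ?_, ?_⟩, ?_⟩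
  · intro f hf
    obtain ⟨i, hi, rfl⟩ := mem_image.mp hf
    exact hvG (hedge i (hIJ i hi))
  · intro e he
    rcases mem_union.mp he with he | he
    · rw [hl'E e he]
      exact hE.subset_label e he
    · obtain ⟨i, hi, rfl⟩ := mem_image.mp he
      rcases mem_union.mp hi with hi | hi
      · rw [hl'I i hi]
        have := hI i hi
        exact image_subset_image fun x hx => by
          rw [mem_Ico] at hx
          rw [mem_range]
          omega
      · rw [hl'J i hi]
        exact image_subset_image (Ico_subset_Ico (hJ i hi).1 (hJ i hi).2)
  · intro e he
    rcases mem_union.mp he with he | he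
    · rw [hl'E e he]
      exact hE.card_label e he
    · obtain ⟨i, hi, rfl⟩ := mem_image.mp he
      rcases mem_union.mp hi with hi | hi
      · rw [hl'I i hi, card_image_of_injective _ hv, card_range]
        omega
      · rw [hl'J i hi, card_image_of_injective _ hv, Nat.card_Ico]
        omega
  · intro e he e' he' hne
    rcases mem_union.mp he with he | he <;> rcases mem_union.mp he' with he' | he'
    · rw [hl'E e he, hl'E e' he'] at hne
      have := hE.card_inter e he e' he' hne
      omega
    · obtain ⟨i, hi, rfl⟩ := mem_image.mp he'
      rw [inter_comm]
      exact hfar i (hIJ i hi) e he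
    · obtain ⟨i, hi, rfl⟩ := mem_image.mp he
      exact hfar i (hIJ i hi) e' he'
    · obtain ⟨i, hi, rfl⟩ := mem_image.mp he
      obtain ⟨j, hj, rfl⟩ := mem_image.mp he'
      rcases mem_union.mp hi with hi | hi <;> rcases mem_union.mp hj with hj | hj
      · exact absurd ((hl'I i hi).trans (hl'I j hj).symm) hne
      · rw [hIJdisj i hi j hj]
        omega
      · rw [inter_comm, hIJdisj j hj i hi]
        omega
      · exact absurd ((hl'J i hi).trans (hl'J j hj).symm) hne
  · rw [card_union_of_disjoint]
    · have : n ≤ ((I ∪ J).image (pathEdge v k)).card + 2 * k :=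
        card_image_pathEdge_halves hv (by omega) hkn
      omega
    · rw [Finset.disjoint_right]
      intro f hf
      obtain ⟨i, hi, rfl⟩ := mem_image.mp hf
      exact hnotE i hi

/-- An arrowing hypergraph has at least `q * (n - 2 * k)` edges whenever `2 ^ q ≤ 2 * k`. -/
theorem mul_le_card_of_arrowsTightPath {n k q : ℕ} {G : Finset (Finset ℕ)}
    (harrow : arrowsTightPath G n k) (hk : 3 ≤ k)
    (hn : k ^ 2 + k ≤ 2 * n) (hq : 2 ^ q ≤ 2 * k) : q * n ≤ G.card + q * (2 * k) := by
  have hind : ∀ j ≤ q, ∃ E ⊆ G, ∃ l, IsSeparated n k (2 ^ (q - j)) E l ∧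
      (j = 0 → E = ∅) ∧ j * n ≤ E.card + j * (2 * k) := by
    intro j
    induction j with
    | zero =>
      exact fun _ => ⟨∅, empty_subset _, id, ⟨by simp, by simp, by simp⟩, fun _ => rfl, by simp⟩
    | succ j ih =>
      intro hj
      obtain ⟨E, hEG, l, hE, hE0, hcard⟩ := ih (by omega)
      have hpow : 2 ^ (q - j) = 2 * 2 ^ (q - (j + 1)) := by
        rw [← pow_succ']
        congr 1
        omega
      rw [hpow] at hE
      have hmono : 2 ^ (q - j) ≤ 2 ^ q := Nat.pow_le_pow_right (by omega) (by omega)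
      have hr : E.Nonempty → 2 * 2 ^ (q - (j + 1)) ≤ k := by
        intro hne
        have hj0 : j ≠ 0 := fun h => hne.ne_empty (hE0 h)
        have h1 : 2 ^ (q - j) ≤ 2 ^ (q - 1) := Nat.pow_le_pow_right (by omega) (by omega)
        have h2 : 2 ^ q = 2 * 2 ^ (q - 1) := by
          rw [← pow_succ']
          congr 1
          omega
        omega
      obtain ⟨E', hE'G, l', hE', hcard'⟩ := hE.exists_extension harrow hEG hk hn hr
        (by positivity) (by omega)
      refine ⟨E', hE'G, l', hE', by simp, ?_⟩
      rw [Nat.succ_mul, Nat.succ_mul]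
      omega
  obtain ⟨E, hEG, -, -, -, hcard⟩ := hind q le_rfl
  have := card_le_card hEG
  omega

/-- For k ≥ 4 and n > (k² + k - 2)/2, the size-Ramsey number of the k-uniform tight
path satisfies R^(k)(P^(k)_{n,k-1}) ≥ ⌈log₂(k+1)⌉·n - 2k². -/
theorem size_ramsey_tight_path_lower_bound (n k : ℕ) (hk : 4 ≤ k)
    (hn : k ^ 2 + k - 2 < 2 * n) :
    ((⌈Real.logb 2 ((k : ℝ) + 1)⌉ : ℝ)) * n - 2 * (k : ℝ) ^ 2
      ≤ (sizeRamseyTightPath n k : ℝ) := by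
  have hn' : k ^ 2 + k ≤ 2 * n := by
    have : Even (k ^ 2 + k) := by
      rw [sq, ← Nat.mul_succ]
      exact Nat.even_mul_succ_self k
    obtain ⟨a, ha⟩ := this
    omega
  have hkn : k ≤ n := by nlinarith
  set q := Nat.clog 2 (k + 1) with hqdef
  have hceil : ⌈Real.logb 2 ((k : ℝ) + 1)⌉ = (q : ℤ) := by
    have := Real.ceil_logb_natCast (b := 2) (r := (k : ℝ) + 1) (by positivity)
    rw [Nat.cast_ofNat] at this
    rw [this, hqdef, ← Int.clog_natCast (R := ℝ)]
    push_cast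
    rfl
  have hpred : 2 ^ (q - 1) ≤ k :=
    Nat.lt_succ_iff.mp (Nat.pow_pred_clog_lt_self (by norm_num) (by omega))
  have hqk : q ≤ k := by
    have := (Nat.lt_two_pow_self (n := q - 1)).trans_le hpred
    omega
  have hq : 2 ^ q ≤ 2 * k := by
    have : 2 ^ q ≤ 2 * 2 ^ (q - 1) := by
      rw [← pow_succ']
      exact Nat.pow_le_pow_right (by omega) (by omega)
    omega
  obtain ⟨G₀, hG₀, harrow₀⟩ := exists_arrowsTightPath hkn
  obtain ⟨G, -, harrow, hcard⟩ := Nat.sInf_mem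
    (s := {m : ℕ | ∃ G : Finset (Finset ℕ),
      (∀ e ∈ G, e.card = k) ∧ arrowsTightPath G n k ∧ G.card = m})
    ⟨_, G₀, hG₀, harrow₀, rfl⟩
  have hmain := mul_le_card_of_arrowsTightPath harrow (by omega) hn' hq
  have hbound : q * n ≤ sizeRamseyTightPath n k + 2 * k ^ 2 := by
    rw [sizeRamseyTightPath, ← hcard]
    nlinarith
  rw [hceil, sub_le_iff_le_add]
  exact_mod_cast hbound
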